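/- If (E,F,G) is a positive flag triple in ℝ^n, then every permutation of it is a positive flag triple; that is, the triples (F,G,E), (G,E,F), (F,E,G), (E,G,F) and (G,F,E) are all generic with all their triple ratios positive. -/

import Mathlib

open Module

/-- A flag in `ℝⁿ`: a family of nested linear subspaces `F⁰ ⊆ F¹ ⊆ ⋯ ⊆ Fⁿ`
where each `Fᵃ` has dimension `a`. -/
structure FlagRn (n : ℕ) where
  space : ℕ → Submodule ℝ (Fin n → ℝ)
  mono : ∀ a b : ℕ, a ≤ b → b ≤ n → space a ≤ space b
  finrank_eq : ∀ a : ℕ, a ≤ n → Module.finrank ℝ (space a) = a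

/-- A pair of flags `(E, F)` in `ℝⁿ` is generic if `Eᵃ ∩ Fⁿ⁻ᵃ = 0` for every `0 ≤ a ≤ n`. -/
def GenericPair (n : ℕ) (E F : FlagRn n) : Prop :=
  ∀ a : ℕ, a ≤ n → E.space a ⊓ F.space (n - a) = ⊥

/-- A triple of flags `(E, F, G)` in `ℝⁿ` is generic if each pair among them is generic and
`Eᵃ ∩ Fᵇ ∩ Gᶜ = 0` whenever `a + b + c = n`. -/
def GenericTriple (n : ℕ) (E F G : FlagRn n) : Prop :=
  GenericPair n E F ∧ GenericPair n F G ∧ GenericPair n E G ∧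
    ∀ a b c : ℕ, a + b + c = n → E.space a ⊓ F.space b ⊓ G.space c = ⊥

/-- The wedge product `v 0 ∧ v 1 ∧ ⋯ ∧ v (k-1)` in the exterior algebra of `ℝⁿ`. -/
noncomputable def wedge {n k : ℕ} (v : Fin k → (Fin n → ℝ)) :
    ExteriorAlgebra ℝ (Fin n → ℝ) :=
  (List.ofFn fun i => ExteriorAlgebra.ι ℝ (v i)).prod

/-- `Λᵏ(W)` for a subspace `W ⊆ ℝⁿ`, realized as the subspace of the exterior algebra of `ℝⁿ`
spanned by the wedge products of `k`-tuples of vectors of `W`. -/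
noncomputable def lambdaPow {n : ℕ} (k : ℕ) (W : Submodule ℝ (Fin n → ℝ)) :
    Submodule ℝ (ExteriorAlgebra ℝ (Fin n → ℝ)) :=
  Submodule.span ℝ {ω | ∃ v : Fin k → (Fin n → ℝ), (∀ i, v i ∈ W) ∧ ω = wedge v}

/-- The ratio `ω / ω'` of two elements of the one-dimensional space `Λⁿ(ℝⁿ)`:
the unique real number `r` with `ω = r • ω'` (when `ω' ≠ 0` and both lie in `Λⁿ(ℝⁿ)`). -/
noncomputable def topRatio {n : ℕ} (ω ω' : ExteriorAlgebra ℝ (Fin n → ℝ)) : ℝ :=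
  letI := Classical.dec (∃ r : ℝ, ω = r • ω')
  if h : ∃ r : ℝ, ω = r • ω' then h.choose else 0

/-- A choice of nonzero element of `Λᵏ(Eᵏ)`: the wedge product of (a choice of) basis
of the `k`-dimensional subspace `Eᵏ` of the flag `E`. -/
noncomputable def flagWedge {n : ℕ} (E : FlagRn n) (k : ℕ) : ExteriorAlgebra ℝ (Fin n → ℝ) :=
  letI := Classical.dec (∃ v : Fin k → (Fin n → ℝ), (∀ i, v i ∈ E.space k) ∧ LinearIndependent ℝ v)
  if h : ∃ v : Fin k → (Fin n → ℝ), (∀ i, v i ∈ E.space k) ∧ LinearIndependent ℝ v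
  then wedge h.choose else 0

/-- The triple ratio `T_{abc}(E, F, G)` of a (generic) flag triple. -/
noncomputable def tripleRatio {n : ℕ} (a b c : ℕ) (E F G : FlagRn n) : ℝ :=
  topRatio (flagWedge E (a + 1) * flagWedge F b * flagWedge G (c - 1))
      (flagWedge E (a - 1) * flagWedge F b * flagWedge G (c + 1)) *
    topRatio (flagWedge E a * flagWedge F (b - 1) * flagWedge G (c + 1))
      (flagWedge E a * flagWedge F (b + 1) * flagWedge G (c - 1)) *
    topRatio (flagWedge E (a - 1) * flagWedge F (b + 1) * flagWedge G c)
      (flagWedge E (a + 1) * flagWedge F (b - 1) * flagWedge G c)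

/-- The `a`-th quadruple ratio `Q_a(E, F, G)` of a (generic) flag triple. -/
noncomputable def quadrupleRatio {n : ℕ} (a : ℕ) (E F G : FlagRn n) : ℝ :=
  topRatio (flagWedge E (a - 1) * flagWedge F (n - a) * flagWedge G 1)
      (flagWedge E a * flagWedge F (n - a - 1) * flagWedge G 1) *
    topRatio (flagWedge E a * flagWedge F 1 * flagWedge G (n - a - 1))
      (flagWedge E (a - 1) * flagWedge F 1 * flagWedge G (n - a)) *
    topRatio (flagWedge E (a + 1) * flagWedge F (n - a - 1))
      (flagWedge E (a + 1) * flagWedge G (n - a - 1)) *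
    topRatio (flagWedge E a * flagWedge G (n - a))
      (flagWedge E a * flagWedge F (n - a))

/-- The `a`-th double ratio `D_a(E, F, G, G')` of a (generic) flag quadruple. -/
noncomputable def doubleRatio {n : ℕ} (a : ℕ) (E F G G' : FlagRn n) : ℝ :=
  -(topRatio (flagWedge E a * flagWedge F (n - a - 1) * flagWedge G 1)
        (flagWedge E a * flagWedge F (n - a - 1) * flagWedge G' 1) *
      topRatio (flagWedge E (a - 1) * flagWedge F (n - a) * flagWedge G' 1)
        (flagWedge E (a - 1) * flagWedge F (n - a) * flagWedge G 1))

/-- The image of a flag under a linear automorphism of `ℝⁿ`. -/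
def FlagRn.map {n : ℕ} (φ : (Fin n → ℝ) ≃ₗ[ℝ] (Fin n → ℝ)) (E : FlagRn n) : FlagRn n where
  space k := (E.space k).map (φ : (Fin n → ℝ) →ₗ[ℝ] (Fin n → ℝ))
  mono a b hab hb := Submodule.map_mono (E.mono a b hab hb)
  finrank_eq a ha := by
    rw [LinearEquiv.finrank_map_eq]
    exact E.finrank_eq a ha

/-- A generic flag triple is positive if all its triple ratios are positive. -/
def PositiveTriple (n : ℕ) (E F G : FlagRn n) : Prop :=
  GenericTriple n E F G ∧
    ∀ a b c : ℕ, 1 ≤ a → 1 ≤ b → 1 ≤ c → a + b + c = n → 0 < tripleRatio a b c E F G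

theorem topRatio_smul_smul {n : ℕ} {s : ℝ} (hs : s ≠ 0)
    (x y : ExteriorAlgebra ℝ (Fin n → ℝ)) : topRatio (s • x) (s • y) = topRatio x y := by
  have h : (fun r : ℝ => s • x = r • s • y) = fun r => x = r • y := by
    funext r
    rw [smul_comm r s y, smul_right_inj hs]
  exact congrArg (fun p : ℝ → Prop =>
    letI := Classical.dec (∃ r, p r)
    if h : ∃ r, p r then h.choose else 0) h

theorem topRatio_self_smul {n : ℕ} {r : ℝ} {y : ExteriorAlgebra ℝ (Fin n → ℝ)} (hy : y ≠ 0) :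
    topRatio (r • y) y = r := by
  have h : ∃ t : ℝ, r • y = t • y := ⟨r, rfl⟩
  rw [topRatio, dif_pos h]
  exact (smul_left_injective ℝ hy h.choose_spec).symm

theorem topRatio_eq_zero {n : ℕ} {x y : ExteriorAlgebra ℝ (Fin n → ℝ)}
    (h : ¬∃ r : ℝ, x = r • y) : topRatio x y = 0 :=
  dif_neg h

theorem topRatio_zero_left {n : ℕ} {y : ExteriorAlgebra ℝ (Fin n → ℝ)} (hy : y ≠ 0) :
    topRatio 0 y = 0 := by
  simpa using topRatio_self_smul (r := 0) hy

/-- Exchanging the two arguments of `topRatio` does not change its sign. This includes the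
degenerate values: the hypotheses of the theorem do not exclude that both arguments vanish. -/
theorem sign_topRatio_comm {n : ℕ} (x y : ExteriorAlgebra ℝ (Fin n → ℝ)) :
    SignType.sign (topRatio x y) = SignType.sign (topRatio y x) := by
  by_cases hx : x = 0
  · by_cases hy : y = 0
    · rw [hx, hy]
    · subst hx
      rw [topRatio_zero_left hy, topRatio_eq_zero]
      simpa using hy
  by_cases h : ∃ r : ℝ, x = r • y
  · obtain ⟨r, rfl⟩ := h
    obtain ⟨hr, hy⟩ := smul_ne_zero_iff.mp hx
    have hinv : topRatio y (r • y) = r⁻¹ := by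
      simpa [smul_smul, inv_mul_cancel₀ hr] using topRatio_self_smul (r := r⁻¹) hx
    rw [topRatio_self_smul hy, hinv]
    rcases lt_or_gt_of_ne hr with h | h
    · rw [sign_neg h, sign_neg (inv_lt_zero.mpr h)]
    · rw [sign_pos h, sign_pos (inv_pos.mpr h)]
  · rw [topRatio_eq_zero h]
    by_cases h' : ∃ r : ℝ, y = r • x
    · obtain ⟨r, rfl⟩ := h'
      rcases eq_or_ne r 0 with rfl | hr
      · rw [zero_smul, topRatio_zero_left hx]
      · exact absurd ⟨r⁻¹, by rw [smul_smul, inv_mul_cancel₀ hr, one_smul]⟩ h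
    · rw [topRatio_eq_zero h']

theorem ι_mul_prod_map_ι {M : Type*} [AddCommGroup M] [Module ℝ M] (x : M) (l : List M) :
    ExteriorAlgebra.ι ℝ x * (l.map (ExteriorAlgebra.ι ℝ)).prod =
      (-1 : ℝ) ^ l.length • ((l.map (ExteriorAlgebra.ι ℝ)).prod * ExteriorAlgebra.ι ℝ x) := by
  induction l with
  | nil => simp
  | cons y l ih =>
    have h : ExteriorAlgebra.ι ℝ x * ExteriorAlgebra.ι ℝ y =
        -(ExteriorAlgebra.ι ℝ y * ExteriorAlgebra.ι ℝ x) :=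
      eq_neg_of_add_eq_zero_left (ExteriorAlgebra.ι_add_mul_swap x y)
    rw [List.map_cons, List.prod_cons, ← mul_assoc, h, neg_mul, mul_assoc, ih, List.length_cons,
      pow_succ, mul_smul_comm, mul_neg_one, neg_smul, mul_assoc]

theorem prod_map_ι_mul_prod_map_ι {M : Type*} [AddCommGroup M] [Module ℝ M] (k l : List M) :
    (k.map (ExteriorAlgebra.ι ℝ)).prod * (l.map (ExteriorAlgebra.ι ℝ)).prod =
      (-1 : ℝ) ^ (k.length * l.length) •
        ((l.map (ExteriorAlgebra.ι ℝ)).prod * (k.map (ExteriorAlgebra.ι ℝ)).prod) := by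
  induction k with
  | nil => simp
  | cons x k ih =>
    rw [List.map_cons, List.prod_cons, mul_assoc, ih, mul_smul_comm, ← mul_assoc,
      ι_mul_prod_map_ι, smul_mul_assoc, smul_smul, ← pow_add, List.length_cons, add_mul, one_mul,
      mul_assoc]

theorem flagWedge_mul_comm {n : ℕ} (E F : FlagRn n) (k l : ℕ) :
    flagWedge E k * flagWedge F l = (-1 : ℝ) ^ (k * l) • (flagWedge F l * flagWedge E k) := by
  unfold flagWedge
  split_ifs with h₁ h₂
  · have h := prod_map_ι_mul_prod_map_ι (List.ofFn h₁.choose) (List.ofFn h₂.choose)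
    rw [List.map_ofFn, List.map_ofFn, List.length_ofFn, List.length_ofFn] at h
    exact h
  all_goals simp

theorem flagWedge_mul_left_comm {n : ℕ} (E F G : FlagRn n) (i j k : ℕ) :
    flagWedge E i * flagWedge F j * flagWedge G k =
      (-1 : ℝ) ^ (i * j) • (flagWedge F j * flagWedge E i * flagWedge G k) := by
  rw [flagWedge_mul_comm E F, smul_mul_assoc]

theorem flagWedge_mul_rotate {n : ℕ} (E F G : FlagRn n) (i j k : ℕ) :
    flagWedge E i * flagWedge F j * flagWedge G k =
      (-1 : ℝ) ^ (i * (j + k)) • (flagWedge F j * flagWedge G k * flagWedge E i) := by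
  rw [flagWedge_mul_left_comm, mul_assoc, flagWedge_mul_comm E G, mul_smul_comm, smul_smul,
    ← pow_add, ← mul_add, mul_assoc]

theorem topRatio_swap {n : ℕ} (E F G : FlagRn n) {i j k i' j' k' : ℕ}
    (h : Even (i * j + i' * j')) :
    topRatio (flagWedge E i * flagWedge F j * flagWedge G k)
        (flagWedge E i' * flagWedge F j' * flagWedge G k') =
      topRatio (flagWedge F j * flagWedge E i * flagWedge G k)
        (flagWedge F j' * flagWedge E i' * flagWedge G k') := by
  have hs : (-1 : ℝ) ^ (i' * j') = (-1) ^ (i * j) :=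
    neg_one_pow_congr (Nat.even_add.mp h).symm
  rw [flagWedge_mul_left_comm E F, flagWedge_mul_left_comm E F, hs,
    topRatio_smul_smul (pow_ne_zero _ (by norm_num))]

theorem topRatio_rotate {n : ℕ} (E F G : FlagRn n) {i j k i' j' k' : ℕ}
    (h : Even (i * (j + k) + i' * (j' + k'))) :
    topRatio (flagWedge E i * flagWedge F j * flagWedge G k)
        (flagWedge E i' * flagWedge F j' * flagWedge G k') =
      topRatio (flagWedge F j * flagWedge G k * flagWedge E i)
        (flagWedge F j' * flagWedge G k' * flagWedge E i') := by
  have hs : (-1 : ℝ) ^ (i' * (j' + k')) = (-1) ^ (i * (j + k)) :=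
    neg_one_pow_congr (Nat.even_add.mp h).symm
  rw [flagWedge_mul_rotate E F, flagWedge_mul_rotate E F, hs,
    topRatio_smul_smul (pow_ne_zero _ (by norm_num))]

theorem tripleRatio_rotate {n : ℕ} (E F G : FlagRn n) {a b c : ℕ} (ha : 1 ≤ a) (hb : 1 ≤ b)
    (hc : 1 ≤ c) : tripleRatio b c a F G E = tripleRatio a b c E F G := by
  obtain ⟨a, rfl⟩ := Nat.exists_eq_add_of_le' ha
  obtain ⟨b, rfl⟩ := Nat.exists_eq_add_of_le' hb
  obtain ⟨c, rfl⟩ := Nat.exists_eq_add_of_le' hc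
  simp only [tripleRatio, Nat.add_sub_cancel]
  rw [topRatio_rotate E F G (i := a + 1 + 1), topRatio_rotate E F G (i := a + 1),
    topRatio_rotate E F G (i := a)]
  · ring
  all_goals simp only [Nat.even_add, Nat.even_mul, Nat.even_add_one]; tauto

theorem sign_tripleRatio_swap {n : ℕ} (E F G : FlagRn n) {a b c : ℕ} (ha : 1 ≤ a) (hb : 1 ≤ b)
    (hc : 1 ≤ c) :
    SignType.sign (tripleRatio b a c F E G) = SignType.sign (tripleRatio a b c E F G) := by
  obtain ⟨a, rfl⟩ := Nat.exists_eq_add_of_le' ha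
  obtain ⟨b, rfl⟩ := Nat.exists_eq_add_of_le' hb
  obtain ⟨c, rfl⟩ := Nat.exists_eq_add_of_le' hc
  simp only [tripleRatio, Nat.add_sub_cancel, sign_mul]
  rw [topRatio_swap E F G (i := a + 1 + 1), topRatio_swap E F G (i := a + 1),
    topRatio_swap E F G (i := a),
    sign_topRatio_comm (flagWedge F (b + 1) * flagWedge E (a + 1 + 1) * _),
    sign_topRatio_comm (flagWedge F b * flagWedge E (a + 1) * _),
    sign_topRatio_comm (flagWedge F (b + 1 + 1) * flagWedge E a * _)]
  · ac_rfl
  all_goals simp only [Nat.even_add, Nat.even_mul, Nat.even_add_one]; tauto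

theorem GenericPair.symm {n : ℕ} {E F : FlagRn n} (h : GenericPair n E F) :
    GenericPair n F E := by
  intro a ha
  have := h (n - a) (Nat.sub_le n a)
  rwa [Nat.sub_sub_self ha, inf_comm] at this

theorem GenericTriple.rotate {n : ℕ} {E F G : FlagRn n} (h : GenericTriple n E F G) :
    GenericTriple n F G E := by
  obtain ⟨hEF, hFG, hEG, h⟩ := h
  refine ⟨hFG, hEG.symm, hEF.symm, fun a b c habc => ?_⟩
  rw [inf_comm, ← inf_assoc]
  exact h c a b (by omega)

theorem GenericTriple.swap {n : ℕ} {E F G : FlagRn n} (h : GenericTriple n E F G) :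
    GenericTriple n F E G := by
  obtain ⟨hEF, hFG, hEG, h⟩ := h
  refine ⟨hEF.symm, hEG, hFG, fun a b c habc => ?_⟩
  rw [inf_comm (F.space a)]
  exact h b a c (by omega)

theorem PositiveTriple.rotate {n : ℕ} {E F G : FlagRn n} (h : PositiveTriple n E F G) :
    PositiveTriple n F G E := by
  refine ⟨h.1.rotate, fun b c a hb hc ha habc => ?_⟩
  rw [tripleRatio_rotate E F G ha hb hc]
  exact h.2 a b c ha hb hc (by omega)

theorem PositiveTriple.swap {n : ℕ} {E F G : FlagRn n} (h : PositiveTriple n E F G) :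
    PositiveTriple n F E G := by
  refine ⟨h.1.swap, fun b a c hb ha hc habc => ?_⟩
  rw [← sign_eq_one_iff, sign_tripleRatio_swap E F G ha hb hc, sign_eq_one_iff]
  exact h.2 a b c ha hb hc (by omega)

/-- If `(E,F,G)` is a positive flag triple in `ℝⁿ`, then every
permutation of it is a positive flag triple. -/
theorem stmt_14 (n : ℕ) (E F G : FlagRn n) (h : PositiveTriple n E F G) :
    PositiveTriple n F G E ∧ PositiveTriple n G E F ∧ PositiveTriple n F E G ∧
      PositiveTriple n E G F ∧ PositiveTriple n G F E :=
  ⟨h.rotate, h.rotate.rotate, h.swap, h.swap.rotate, h.swap.rotate.rotate⟩
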